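/- arXiv:2404.03604 — 2 statements merged into one kernel-verified Lean document; each statement's English description precedes it below -/
import Mathlib

section
/- For every integer inventory vector x ∈ ℤ_{≥0}^n, every product i ∈ {1,…,n}, and every number of customers T ∈ ℕ, the expected stochastic consumption is at least a (1 − 1/e) fraction of the fluid consumption: Z_i(x,T) ≥ (1 − 1/e)·Z_i^FP(x,T). -/
open Finset

/-- The no-purchase fluid quantity `Z₀^FP(x,T)`: the unique `z ≥ 0` with
`z + ∑ i min(vᵢ z, xᵢ) = T` (we take the infimum of the solution set, which is a singleton). -/
noncomputable def Z0FP {n : ℕ} (v x : Fin n → ℝ) (T : ℝ) : ℝ :=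
  sInf {z : ℝ | 0 ≤ z ∧ z + ∑ i, min (v i * z) (x i) = T}

/-- Fluid consumption of product `i`: `Z_i^FP(x,T) = min(vᵢ Z₀^FP(x,T), xᵢ)`. -/
noncomputable def ZFP {n : ℕ} (v x : Fin n → ℝ) (i : Fin n) (T : ℝ) : ℝ :=
  min (v i * Z0FP v x T) (x i)

/-- Fluid revenue `f^FP(x,T) = ∑ i rᵢ Z_i^FP(x,T)`. -/
noncomputable def fFP {n : ℕ} (r v x : Fin n → ℝ) (T : ℝ) : ℝ :=
  ∑ i, r i * ZFP v x i T

/-- Expected consumption `Z_i(x,T)` of product `i` in the stochastic consumption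
process without personalization under MNL, defined recursively over the number
of customers `T`.  `N(x) = {k : x_k ≥ 1}` is the set of available products and
`φ(j,S) = v_j / (1 + ∑_{k∈S} v_k)` (outside option weight `1`). -/
noncomputable def Zstoch {n : ℕ} (v : Fin n → ℝ) (i : Fin n) : ℕ → (Fin n → ℕ) → ℝ
  | 0, _ => 0
  | T + 1, x =>
    (∑ j ∈ Finset.univ.filter (fun k => 1 ≤ x k),
      v j / (1 + ∑ k ∈ Finset.univ.filter (fun k => 1 ≤ x k), v k) *
        ((if j = i then 1 else 0) +
          Zstoch v i T (fun k => if k = j then x k - 1 else x k))) +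
    (1 / (1 + ∑ k ∈ Finset.univ.filter (fun k => 1 ≤ x k), v k)) * Zstoch v i T x

/-- Inventory after one unit of product `j` is sold. -/
def sellUnit {n : ℕ} (j : Fin n) (x : Fin n → ℕ) : Fin n → ℕ :=
  fun k => if k = j then x k - 1 else x k

/-- The products other than `i` that are in stock. -/
def stockedOther {n : ℕ} (i : Fin n) (x : Fin n → ℕ) : Finset (Fin n) :=
  (univ.erase i).filter (fun k => 1 ≤ x k)

/-- Expected number of no-purchases among `T` customers when product `i` never runs out. -/
noncomputable def outsideCount {n : ℕ} (v : Fin n → ℝ) (i : Fin n) : ℕ → (Fin n → ℕ) → ℝ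
  | 0, _ => 0
  | T + 1, x =>
    (1 + (1 + v i) * outsideCount v i T x +
      ∑ k ∈ stockedOther i x, v k * outsideCount v i T (sellUnit k x)) /
    (1 + v i + ∑ k ∈ stockedOther i x, v k)

section Inventory

variable {n : ℕ} {i j : Fin n} {x : Fin n → ℕ}

lemma mem_stockedOther {k : Fin n} : k ∈ stockedOther i x ↔ k ≠ i ∧ 1 ≤ x k := by
  simp [stockedOther]

lemma sellUnit_comm (j k : Fin n) (x : Fin n → ℕ) :
    sellUnit j (sellUnit k x) = sellUnit k (sellUnit j x) := by
  funext l
  simp only [sellUnit]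
  split_ifs <;> rfl

lemma stockedOther_sellUnit_self (i : Fin n) (x : Fin n → ℕ) :
    stockedOther i (sellUnit i x) = stockedOther i x := by
  ext k
  simp only [mem_stockedOther, sellUnit]
  constructor <;> rintro ⟨h1, h2⟩ <;> simp_all

lemma stockedOther_sellUnit (h : 2 ≤ x j) :
    stockedOther i (sellUnit j x) = stockedOther i x := by
  ext k
  simp only [mem_stockedOther, sellUnit]
  split_ifs with hk
  · subst hk; constructor <;> rintro ⟨h1, h2⟩ <;> exact ⟨h1, by omega⟩
  · rfl

lemma notMem_stockedOther_sellUnit (h : x j = 1) : j ∉ stockedOther i (sellUnit j x) := by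
  simp [mem_stockedOther, sellUnit, h]

lemma stockedOther_eq_insert (hj : j ≠ i) (h : x j = 1) :
    stockedOther i x = insert j (stockedOther i (sellUnit j x)) := by
  ext k
  simp only [mem_stockedOther, sellUnit, mem_insert]
  by_cases hk : k = j
  · subst hk; simp [hj, h]
  · simp [hk]

lemma mem_stockedOther_sellUnit {k : Fin n} (hj : j ∈ stockedOther i x)
    (h : 2 ≤ x j ∨ j ≠ k) : j ∈ stockedOther i (sellUnit k x) := by
  rw [mem_stockedOther] at hj ⊢
  refine ⟨hj.1, ?_⟩
  simp only [sellUnit]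
  have := hj.2
  split_ifs with hk
  · rcases h with h | h
    · omega
    · exact absurd hk h
  · exact this

end Inventory

section OutsideCount

variable {n : ℕ} {v : Fin n → ℝ}

lemma outsideDenom_pos (hv : ∀ i, 0 < v i) (i : Fin n)
    (x : Fin n → ℕ) : 0 < 1 + v i + ∑ k ∈ stockedOther i x, v k := by
  have h1 := hv i
  have h2 : 0 ≤ ∑ k ∈ stockedOther i x, v k := sum_nonneg fun k _ => (hv k).le
  linarith

lemma outsideCount_succ_mul (hv : ∀ i, 0 < v i) (i : Fin n)
    (T : ℕ) (x : Fin n → ℕ) :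
    (1 + v i + ∑ k ∈ stockedOther i x, v k) * outsideCount v i (T + 1) x =
      1 + (1 + v i) * outsideCount v i T x +
      ∑ k ∈ stockedOther i x, v k * outsideCount v i T (sellUnit k x) := by
  rw [outsideCount, mul_div_cancel₀ _ (outsideDenom_pos hv i x).ne']

lemma outsideCount_nonneg (hv : ∀ i, 0 < v i) (i : Fin n)
    (T : ℕ) (x : Fin n → ℕ) : 0 ≤ outsideCount v i T x := by
  induction T generalizing x with
  | zero => simp [outsideCount]
  | succ T ih =>
    have h2 : 0 ≤ ∑ k ∈ stockedOther i x, v k * outsideCount v i T (sellUnit k x) :=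
      sum_nonneg fun k _ => mul_nonneg (hv k).le (ih _)
    have h3 := mul_nonneg (by linarith [hv i] : (0 : ℝ) ≤ 1 + v i) (ih x)
    exact div_nonneg (by linarith) (outsideDenom_pos hv i x).le

lemma outsideCount_le_succ (hv : ∀ i, 0 < v i) (i : Fin n)
    (T : ℕ) (x : Fin n → ℕ) :
    outsideCount v i T x ≤ outsideCount v i (T + 1) x := by
  induction T generalizing x with
  | zero => exact outsideCount_nonneg hv i 1 x
  | succ T ih =>
    refine le_of_mul_le_mul_left ?_ (outsideDenom_pos hv i x)
    rw [outsideCount_succ_mul hv, outsideCount_succ_mul hv]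
    have h3 := mul_le_mul_of_nonneg_left (ih x) (by linarith [hv i] : (0 : ℝ) ≤ 1 + v i)
    have h4 : ∑ k ∈ stockedOther i x, v k * outsideCount v i T (sellUnit k x) ≤
        ∑ k ∈ stockedOther i x, v k * outsideCount v i (T + 1) (sellUnit k x) :=
      sum_le_sum fun k _ => mul_le_mul_of_nonneg_left (ih _) (hv k).le
    linarith

lemma outsideCount_sellUnit_self (i : Fin n) (T : ℕ) (x : Fin n → ℕ) :
    outsideCount v i T (sellUnit i x) = outsideCount v i T x := by
  induction T generalizing x with
  | zero => rfl
  | succ T ih =>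
    simp only [outsideCount, stockedOther_sellUnit_self, ih, sellUnit_comm _ i]

lemma outsideCount_le_sellUnit (hv : ∀ i, 0 < v i) (i : Fin n)
    (T : ℕ) {x : Fin n → ℕ} {j : Fin n} (hj : j ∈ stockedOther i x) :
    outsideCount v i T x ≤ outsideCount v i T (sellUnit j x) := by
  induction T generalizing x with
  | zero => exact le_rfl
  | succ T ih =>
    have ha : (0 : ℝ) ≤ 1 + v i := by linarith [hv i]
    refine le_of_mul_le_mul_left ?_ (outsideDenom_pos hv i x)
    have h3 := mul_le_mul_of_nonneg_left (ih hj) ha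
    have hE := outsideCount_succ_mul hv i T (sellUnit j x)
    have hx := mem_stockedOther.1 hj
    rw [outsideCount_succ_mul hv]
    rcases (show 2 ≤ x j ∨ x j = 1 by omega) with h | h
    · rw [stockedOther_sellUnit h] at hE
      rw [hE]
      have h4 : ∑ k ∈ stockedOther i x, v k * outsideCount v i T (sellUnit k x) ≤
          ∑ k ∈ stockedOther i x, v k * outsideCount v i T (sellUnit k (sellUnit j x)) := by
        refine sum_le_sum fun k _ => mul_le_mul_of_nonneg_left ?_ (hv k).le
        rw [sellUnit_comm]
        exact ih (mem_stockedOther_sellUnit hj (.inl h))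
      linarith
    · rw [stockedOther_eq_insert hx.1 h, sum_insert (notMem_stockedOther_sellUnit h),
        sum_insert (notMem_stockedOther_sellUnit h)]
      have h4 : ∑ k ∈ stockedOther i (sellUnit j x), v k * outsideCount v i T (sellUnit k x) ≤
          ∑ k ∈ stockedOther i (sellUnit j x),
            v k * outsideCount v i T (sellUnit k (sellUnit j x)) := by
        refine sum_le_sum fun k hk => mul_le_mul_of_nonneg_left ?_ (hv k).le
        rw [sellUnit_comm]
        refine ih (mem_stockedOther_sellUnit hj (.inr ?_))
        rintro rfl
        exact notMem_stockedOther_sellUnit h hk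
      have h5 := mul_le_mul_of_nonneg_left (outsideCount_le_succ hv i T (sellUnit j x)) (hv j).le
      linarith

lemma outsideCount_sellUnit_le_succ (hv : ∀ i, 0 < v i) (i : Fin n)
    (T : ℕ) {x : Fin n → ℕ} {j : Fin n}
    (hj : j ∈ stockedOther i x) :
    outsideCount v i T (sellUnit j x) ≤ outsideCount v i (T + 1) x := by
  induction T generalizing x with
  | zero => exact outsideCount_nonneg hv i 1 x
  | succ T ih =>
    have ha : (0 : ℝ) ≤ 1 + v i := by linarith [hv i]
    refine le_of_mul_le_mul_left ?_ (outsideDenom_pos hv i x)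
    have h3 := mul_le_mul_of_nonneg_left (ih hj) ha
    have hE := outsideCount_succ_mul hv i T (sellUnit j x)
    have hx := mem_stockedOther.1 hj
    rw [outsideCount_succ_mul hv i (T + 1)]
    rcases (show 2 ≤ x j ∨ x j = 1 by omega) with h | h
    · rw [stockedOther_sellUnit h] at hE
      rw [hE]
      have h4 : ∑ k ∈ stockedOther i x, v k * outsideCount v i T (sellUnit k (sellUnit j x)) ≤
          ∑ k ∈ stockedOther i x, v k * outsideCount v i (T + 1) (sellUnit k x) := by
        refine sum_le_sum fun k _ => mul_le_mul_of_nonneg_left ?_ (hv k).le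
        rw [sellUnit_comm]
        exact ih (mem_stockedOther_sellUnit hj (.inl h))
      linarith
    · rw [stockedOther_eq_insert hx.1 h, sum_insert (notMem_stockedOther_sellUnit h),
        sum_insert (notMem_stockedOther_sellUnit h)]
      have h4 : ∑ k ∈ stockedOther i (sellUnit j x),
            v k * outsideCount v i T (sellUnit k (sellUnit j x)) ≤
          ∑ k ∈ stockedOther i (sellUnit j x),
            v k * outsideCount v i (T + 1) (sellUnit k x) := by
        refine sum_le_sum fun k hk => mul_le_mul_of_nonneg_left ?_ (hv k).le
        rw [sellUnit_comm]
        refine ih (mem_stockedOther_sellUnit hj (.inr ?_))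
        rintro rfl
        exact notMem_stockedOther_sellUnit h hk
      linarith

/-- One-step inequality for the fluid consumption of a product `k ≠ i`, by concavity of `min`. -/
lemma denom_mul_min_outsideCount_ge (hv : ∀ i, 0 < v i) (i : Fin n)
    (T : ℕ) (x : Fin n → ℕ) {k : Fin n} (hk : k ≠ i) :
    (if 1 ≤ x k then v k else 0) + (1 + v i) * min (v k * outsideCount v i T x) (x k) +
      ∑ l ∈ stockedOther i x,
        v l * min (v k * outsideCount v i T (sellUnit l x)) (sellUnit l x k) ≤
    (1 + v i + ∑ l ∈ stockedOther i x, v l) *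
      min (v k * outsideCount v i (T + 1) x) (x k) := by
  have ha : (0 : ℝ) ≤ 1 + v i := by linarith [hv i]
  by_cases h : 1 ≤ x k
  · rw [if_pos h, mul_min_of_nonneg _ _ (outsideDenom_pos hv i x).le, le_min_iff]
    have hkm : k ∈ stockedOther i x := mem_stockedOther.2 ⟨hk, h⟩
    constructor
    · have e1 : ∑ l ∈ stockedOther i x,
          v l * min (v k * outsideCount v i T (sellUnit l x)) (sellUnit l x k) ≤
          v k * ∑ l ∈ stockedOther i x, v l * outsideCount v i T (sellUnit l x) := by
        rw [mul_sum]
        refine sum_le_sum fun l _ => ?_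
        have := mul_le_mul_of_nonneg_left
          (min_le_left (v k * outsideCount v i T (sellUnit l x)) (sellUnit l x k : ℝ)) (hv l).le
        linarith
      have e2 := mul_le_mul_of_nonneg_left
        (min_le_left (v k * outsideCount v i T x) (x k : ℝ)) ha
      have e3 := congrArg (v k * ·) (outsideCount_succ_mul hv i T x)
      linarith
    · have e1 : ∑ l ∈ stockedOther i x,
          v l * min (v k * outsideCount v i T (sellUnit l x)) (sellUnit l x k) ≤
          ∑ l ∈ stockedOther i x, (v l * (x k : ℝ) - if k = l then v l else 0) := by
        refine sum_le_sum fun l _ => ?_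
        refine (mul_le_mul_of_nonneg_left (min_le_right _ _) (hv l).le).trans ?_
        simp only [sellUnit]
        split_ifs with hkl
        · rw [Nat.cast_sub h]; simp; linarith
        · simp
      rw [sum_sub_distrib, sum_ite_eq, if_pos hkm, ← sum_mul] at e1
      have e2 := mul_le_mul_of_nonneg_left
        (min_le_right (v k * outsideCount v i T x) (x k : ℝ)) ha
      linarith
  · have h0 : x k = 0 := by omega
    have hs (l : Fin n) : sellUnit l x k = 0 := by simp [sellUnit, h0]
    have hm (S : ℕ) (y : Fin n → ℕ) : min (v k * outsideCount v i S y) (0 : ℝ) = 0 :=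
      min_eq_right (mul_nonneg (hv k).le (outsideCount_nonneg hv i S y))
    simp [h0, hs, hm]

lemma customers_le_fluidLevel_outsideCount (hv : ∀ i, 0 < v i) (i : Fin n)
    (T : ℕ) (x : Fin n → ℕ) :
    (T : ℝ) ≤ (1 + v i) * outsideCount v i T x +
      ∑ k ∈ univ.erase i, min (v k * outsideCount v i T x) (x k) := by
  induction T generalizing x with
  | zero => simp [outsideCount]
  | succ T ih =>
    have ha : (0 : ℝ) ≤ 1 + v i := by linarith [hv i]
    refine le_of_mul_le_mul_left ?_ (outsideDenom_pos hv i x)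
    have h1 : ∑ k ∈ univ.erase i, _ ≤ ∑ k ∈ univ.erase i, _ := sum_le_sum fun k hk =>
      denom_mul_min_outsideCount_ge hv i T x (ne_of_mem_erase hk)
    rw [sum_add_distrib, sum_add_distrib, ← sum_filter, ← mul_sum, ← mul_sum, sum_comm] at h1
    simp only [← mul_sum] at h1
    change ∑ k ∈ stockedOther i x, v k + _ + _ ≤ _ at h1
    have h2 := mul_le_mul_of_nonneg_left (ih x) ha
    have h3 : ∑ l ∈ stockedOther i x, v l * (T : ℝ) ≤ ∑ l ∈ stockedOther i x, v l * _ :=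
      sum_le_sum fun l _ => mul_le_mul_of_nonneg_left (ih (sellUnit l x)) (hv l).le
    simp only [mul_add, sum_add_distrib] at h3
    rw [← sum_mul] at h3
    have h4 : ∑ l ∈ stockedOther i x, v l * ((1 + v i) * outsideCount v i T (sellUnit l x)) =
        (1 + v i) * ∑ l ∈ stockedOther i x, v l * outsideCount v i T (sellUnit l x) := by
      rw [mul_sum]
      exact sum_congr rfl fun l _ => by ring
    have h5 := congrArg ((1 + v i) * ·) (outsideCount_succ_mul hv i T x)
    push_cast
    simp only [one_mul, mul_one, mul_add, add_mul, sum_add_distrib] at *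
    linarith

end OutsideCount

/-- Concave lower bound for the expected consumption of a product with `m` units in stock,
in terms of its expected consumption `g` under unlimited stock. -/
noncomputable def expCap (m g : ℝ) : ℝ := m * (1 - Real.exp (-g / m))

section ExpCap

lemma expCap_tangent {m g G : ℝ} (hm : 0 < m) :
    expCap m G - expCap m g ≤ Real.exp (-g / m) * (G - g) := by
  have h := Real.add_one_le_exp (-(G - g) / m)
  have e : Real.exp (-G / m) = Real.exp (-g / m) * Real.exp (-(G - g) / m) := by
    rw [← Real.exp_add]; congr 1; ring
  have h2 := mul_le_mul_of_nonneg_left h (mul_pos hm (Real.exp_pos (-g / m))).le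
  have h3 : m * (-(G - g) / m) = -(G - g) := by field_simp
  unfold expCap
  rw [e]
  linear_combination h2 - Real.exp (-g / m) * h3

lemma concaveOn_expCap {m : ℝ} (hm : 0 < m) : ConcaveOn ℝ Set.univ (expCap m) := by
  have h1 : ConvexOn ℝ Set.univ (fun g : ℝ => Real.exp (-g / m)) := by
    have := convexOn_exp.comp_linearMap (LinearMap.mulLeft ℝ (-m⁻¹))
    have e : (fun g : ℝ => Real.exp (-g / m)) = Real.exp ∘ LinearMap.mulLeft ℝ (-m⁻¹) := by
      funext g
      simp [div_eq_inv_mul]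
    rw [e]
    exact this
  have h2 := ((concaveOn_const (1 : ℝ) convex_univ).sub h1).smul hm.le
  exact h2

lemma expCap_secant {m a b c : ℝ} (hm : 0 < m) (hab : a ≤ b) (hbc : b ≤ c) :
    (b - a) * (expCap m c - expCap m a) ≤ (c - a) * (expCap m b - expCap m a) := by
  rcases hab.eq_or_lt with rfl | hab
  · simp
  rcases hbc.eq_or_lt with rfl | hbc
  · exact le_rfl
  have h := (concaveOn_expCap hm).slope_anti_adjacent (Set.mem_univ a) (Set.mem_univ c) hab hbc
  rw [div_le_div_iff₀ (by linarith) (by linarith)] at h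
  linarith

lemma expCap_add_deriv_le (m : ℕ) {g : ℝ} (hg : 0 ≤ g) :
    expCap ((m + 1 : ℕ) : ℝ) g + Real.exp (-g / ((m + 1 : ℕ) : ℝ)) ≤ 1 + expCap m g := by
  unfold expCap
  rcases Nat.eq_zero_or_pos m with rfl | hm
  · simp
  have hm' : (0 : ℝ) < m := by exact_mod_cast hm
  have h : Real.exp (-g / m) ≤ Real.exp (-g / ((m + 1 : ℕ) : ℝ)) := by
    apply Real.exp_le_exp.2
    rw [neg_div, neg_div, neg_le_neg_iff]
    exact div_le_div_of_nonneg_left hg hm' (by push_cast; linarith)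
  have := mul_le_mul_of_nonneg_left h hm'.le
  push_cast at *
  linarith

lemma mul_min_le_expCap {m g : ℝ} (hm : 0 < m) (hg : 0 ≤ g) :
    (1 - 1 / Real.exp 1) * min g m ≤ expCap m g := by
  have hmono : expCap m (min g m) ≤ expCap m g := by
    unfold expCap
    have : Real.exp (-g / m) ≤ Real.exp (-(min g m) / m) := by
      apply Real.exp_le_exp.2
      gcongr
      exact min_le_left _ _
    gcongr
  refine le_trans ?_ hmono
  have h := expCap_secant hm (le_min hg hm.le) (min_le_right g m)
  have h0 : expCap m 0 = 0 := by simp [expCap]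
  have h1 : expCap m m = m * (1 - 1 / Real.exp 1) := by
    simp [expCap, neg_div, div_self hm.ne', Real.exp_neg]
  rw [h0, h1] at h
  refine le_of_mul_le_mul_left ?_ hm
  linarith

end ExpCap

section Stochastic

variable {n : ℕ} {v : Fin n → ℝ}

lemma Zstoch_nonneg (hv : ∀ i, 0 < v i) (i : Fin n)
    (T : ℕ) (x : Fin n → ℕ) : 0 ≤ Zstoch v i T x := by
  induction T generalizing x with
  | zero => simp [Zstoch]
  | succ T ih =>
    have hD : 0 ≤ ∑ k ∈ univ.filter (fun k => 1 ≤ x k), v k := sum_nonneg fun k _ => (hv k).le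
    rw [Zstoch]
    refine add_nonneg (sum_nonneg fun j _ => mul_nonneg (div_nonneg (hv j).le (by linarith))
      (add_nonneg (by split_ifs <;> norm_num) (ih _))) (mul_nonneg (by positivity) (ih _))

lemma Zstoch_succ_mul (hv : ∀ i, 0 < v i) (i : Fin n)
    (T : ℕ) {x : Fin n → ℕ} (hx : 1 ≤ x i) :
    (1 + v i + ∑ k ∈ stockedOther i x, v k) * Zstoch v i (T + 1) x =
      v i * (1 + Zstoch v i T (sellUnit i x)) +
      ∑ k ∈ stockedOther i x, v k * Zstoch v i T (sellUnit k x) + Zstoch v i T x := by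
  have hN : univ.filter (fun k => 1 ≤ x k) = insert i (stockedOther i x) := by
    ext k
    by_cases hk : k = i
    · subst hk; simp [hx]
    · simp [mem_stockedOther, hk]
  have hi : i ∉ stockedOther i x := by simp [mem_stockedOther]
  have hD := (outsideDenom_pos hv i x).ne'
  rw [Zstoch, hN, sum_insert hi, sum_insert hi, ← add_assoc]
  set D := 1 + v i + ∑ k ∈ stockedOther i x, v k
  change D * (v i / D * ((if i = i then 1 else 0) + Zstoch v i T (sellUnit i x)) +
    ∑ j ∈ stockedOther i x, v j / D * ((if j = i then 1 else 0) + Zstoch v i T (sellUnit j x)) +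
    1 / D * Zstoch v i T x) = _
  rw [mul_add, mul_add, mul_sum, if_pos rfl]
  congr 1
  · congr 1
    · field_simp
    · refine sum_congr rfl fun j hj => ?_
      rw [if_neg (mem_stockedOther.1 hj).1]
      field_simp
      ring
  · field_simp

lemma expCap_outsideCount_le_Zstoch (hv : ∀ i, 0 < v i) (i : Fin n)
    (T : ℕ) (x : Fin n → ℕ) :
    expCap (x i) (v i * outsideCount v i T x) ≤ Zstoch v i T x := by
  induction T generalizing x with
  | zero => simp [outsideCount, Zstoch, expCap]
  | succ T ih =>
    rcases Nat.eq_zero_or_pos (x i) with h0 | hx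
    · simpa [h0, expCap] using Zstoch_nonneg hv i (T + 1) x
    have hD := outsideDenom_pos hv i x
    have hm : (0 : ℝ) < x i := by exact_mod_cast hx
    have hvi := hv i
    refine le_of_mul_le_mul_left ?_ hD
    rw [Zstoch_succ_mul hv i T hx]
    have hi := ih (sellUnit i x)
    rw [outsideCount_sellUnit_self] at hi
    have hg0 := mul_nonneg hvi.le (outsideCount_nonneg hv i T x)
    have hcap := expCap_add_deriv_le (x i - 1) hg0
    rw [Nat.sub_add_cancel hx] at hcap
    have hsi : sellUnit i x i = x i - 1 := by simp [sellUnit]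
    rw [hsi] at hi
    have h1 : ∑ k ∈ stockedOther i x, v k * expCap (x i) (v i * outsideCount v i T (sellUnit k x)) ≤
        ∑ k ∈ stockedOther i x, v k * Zstoch v i T (sellUnit k x) := by
      refine sum_le_sum fun k hk => mul_le_mul_of_nonneg_left ?_ (hv k).le
      have := ih (sellUnit k x)
      rwa [show sellUnit k x i = x i by
        simp [sellUnit, (mem_stockedOther.1 hk).1.symm]] at this
    have hrec := congrArg (v i * ·) (outsideCount_succ_mul hv i T x)
    set g := v i * outsideCount v i T x with hg
    set G := v i * outsideCount v i (T + 1) x with hG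
    set E := Real.exp (-g / (x i : ℝ))
    set D := 1 + v i + ∑ k ∈ stockedOther i x, v k with hDdef
    have hstep : D * (G - g) =
        v i + ∑ k ∈ stockedOther i x, v k * (v i * outsideCount v i T (sellUnit k x) - g) := by
      simp only [mul_sub, sum_sub_distrib, ← sum_mul]
      have : ∑ k ∈ stockedOther i x, v k * (v i * outsideCount v i T (sellUnit k x)) =
          v i * ∑ k ∈ stockedOther i x, v k * outsideCount v i T (sellUnit k x) := by
        rw [mul_sum]
        exact sum_congr rfl fun l _ => by ring
      rw [this, hDdef, hG, hg]
      linear_combination hrec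
    have hgj {k : Fin n} (hk : k ∈ stockedOther i x) :
        g ≤ v i * outsideCount v i T (sellUnit k x) :=
      mul_le_mul_of_nonneg_left (outsideCount_le_sellUnit hv i T hk) hvi.le
    have hpos : 0 < G - g := by
      refine pos_of_mul_pos_right ?_ hD.le
      rw [hstep]
      exact add_pos_of_pos_of_nonneg hvi (sum_nonneg fun k hk =>
        mul_nonneg (hv k).le (sub_nonneg.2 (hgj hk)))
    have hsec : (∑ k ∈ stockedOther i x, v k * (v i * outsideCount v i T (sellUnit k x) - g)) *
          (expCap (x i) G - expCap (x i) g) ≤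
        (G - g) * ∑ k ∈ stockedOther i x,
          v k * (expCap (x i) (v i * outsideCount v i T (sellUnit k x)) - expCap (x i) g) := by
      rw [sum_mul, mul_sum]
      refine sum_le_sum fun k hk => ?_
      have := mul_le_mul_of_nonneg_left (expCap_secant hm (hgj hk)
        (mul_le_mul_of_nonneg_left (outsideCount_sellUnit_le_succ hv i T hk) hvi.le)) (hv k).le
      linarith
    have htan := mul_le_mul_of_nonneg_left (expCap_tangent (g := g) (G := G) hm) hvi.le
    have hkey : D * (expCap (x i) G - expCap (x i) g) ≤ v i * E + ∑ k ∈ stockedOther i x,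
          v k * (expCap (x i) (v i * outsideCount v i T (sellUnit k x)) - expCap (x i) g) := by
      refine le_of_mul_le_mul_left ?_ hpos
      linear_combination hsec + htan + (expCap (x i) G - expCap (x i) g) * hstep
    simp only [mul_sub, sum_sub_distrib, ← sum_mul] at hkey
    have h6 := mul_le_mul_of_nonneg_left
      (hcap.trans (add_le_add le_rfl hi)) hvi.le
    have h7 := ih x
    rw [← hg] at h7
    have hDg : D * expCap (x i) g = (1 + v i + ∑ k ∈ stockedOther i x, v k) * expCap (x i) g := rfl
    linarith

lemma ZFP_le_min_outsideCount (hv : ∀ i, 0 < v i) (i : Fin n)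
    (T : ℕ) (x : Fin n → ℕ) :
    ZFP v (fun k => (x k : ℝ)) i T ≤ min (v i * outsideCount v i T x) (x i) := by
  have hw := mul_nonneg (hv i).le (outsideCount_nonneg hv i T x)
  refine le_min ?_ (min_le_right _ _)
  unfold ZFP Z0FP
  rcases Set.eq_empty_or_nonempty
    {z : ℝ | 0 ≤ z ∧ z + ∑ k, min (v k * z) (x k : ℝ) = T} with hS | ⟨z, hz⟩
  · rw [hS, Real.sInf_empty]
    exact (min_le_left _ _).trans (by simpa using hw)
  have hle := csInf_le (⟨0, fun y hy => hy.1⟩ : BddBelow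
    {z : ℝ | 0 ≤ z ∧ z + ∑ k, min (v k * z) (x k : ℝ) = T}) hz
  refine (min_le_min_right _ (mul_le_mul_of_nonneg_left hle (hv i).le)).trans ?_
  by_contra! hlt
  have hzw : outsideCount v i T x < z :=
    lt_of_mul_lt_mul_left (hlt.trans_le (min_le_left _ _)) (hv i).le
  have h1 := hz.2
  rw [← add_sum_erase _ _ (mem_univ i)] at h1
  have h2 : ∑ k ∈ univ.erase i, min (v k * outsideCount v i T x) (x k : ℝ) ≤
      ∑ k ∈ univ.erase i, min (v k * z) (x k : ℝ) := sum_le_sum fun k _ =>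
    min_le_min_right _ (mul_le_mul_of_nonneg_left hzw.le (hv k).le)
  have h3 := customers_le_fluidLevel_outsideCount hv i T x
  linarith

end Stochastic

theorem stmt13 {n : ℕ} (hn : 1 ≤ n) (r v : Fin n → ℝ)
    (hr : ∀ i j : Fin n, i ≤ j → r j ≤ r i) (hr0 : ∀ i, 0 ≤ r i)
    (hv : ∀ i, 0 < v i)
    (x : Fin n → ℕ) (i : Fin n) (T : ℕ) :
    (1 - 1 / Real.exp 1) * ZFP v (fun k => (x k : ℝ)) i (T : ℝ) ≤ Zstoch v i T x := by
  refine (mul_le_mul_of_nonneg_left (ZFP_le_min_outsideCount hv i T x) ?_).trans ?_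
  · rw [sub_nonneg, div_le_one (Real.exp_pos 1)]
    exact Real.one_le_exp zero_le_one
  rcases Nat.eq_zero_or_pos (x i) with h0 | hx
  · have hw := mul_nonneg (hv i).le (outsideCount_nonneg hv i T x)
    simpa [h0, min_eq_right hw] using Zstoch_nonneg hv i T x
  · exact (mul_min_le_expCap (by exact_mod_cast hx)
      (mul_nonneg (hv i).le (outsideCount_nonneg hv i T x))).trans
      (expCap_outsideCount_le_Zstoch hv i T x)
end

section
/- Let T be a random variable with values in the nonnegative integers having the IFR property and finite mean μ_T. Then for every integer inventory vector x ∈ ℤ_{≥0}^n and every product i ∈ {1,…,n}, E_T[Z_i(x,T)] ≥ (1/e)·Z_i^FP(x, μ_T). -/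
open Finset

/-- Tail probability `P(T ≥ k)` of a distribution on `ℕ` given by the pmf `q`. -/
noncomputable def tailP (q : ℕ → ℝ) (k : ℕ) : ℝ := ∑' j : ℕ, q (k + j)

/-- Increasing failure rate property: the hazard rate `k ↦ q k / P(T ≥ k)` is
nondecreasing (stated in cross-multiplied form). -/
def IFR (q : ℕ → ℝ) : Prop := ∀ k : ℕ, q k * tailP q (k + 1) ≤ q (k + 1) * tailP q k

open Filter Topology

/-! ### Truncated binomial means -/

/-- The expectation of `min(Bin(t, θ), c)`, defined by conditioning on the first trial. -/
noncomputable def truncBinomMean (θ : ℝ) : ℕ → ℕ → ℝ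
  | 0, _ => 0
  | _ + 1, 0 => 0
  | t + 1, c + 1 => θ * (1 + truncBinomMean θ t c) + (1 - θ) * truncBinomMean θ t (c + 1)

lemma truncBinomMean_zero_left (θ : ℝ) (c : ℕ) : truncBinomMean θ 0 c = 0 := by
  simp [truncBinomMean]

lemma truncBinomMean_zero_right (θ : ℝ) (t : ℕ) : truncBinomMean θ t 0 = 0 := by
  cases t <;> simp [truncBinomMean]

lemma truncBinomMean_succ_succ (θ : ℝ) (t c : ℕ) :
    truncBinomMean θ (t + 1) (c + 1) =
      θ * (1 + truncBinomMean θ t c) + (1 - θ) * truncBinomMean θ t (c + 1) := by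
  simp [truncBinomMean]

lemma truncBinomMean_nonneg {θ : ℝ} (h0 : 0 ≤ θ) (h1 : θ ≤ 1) (t c : ℕ) :
    0 ≤ truncBinomMean θ t c := by
  induction t generalizing c with
  | zero => simp [truncBinomMean_zero_left]
  | succ t ih =>
    cases c with
    | zero => simp [truncBinomMean_zero_right]
    | succ c =>
      rw [truncBinomMean_succ_succ]
      have := ih c
      have := ih (c + 1)
      have : 0 ≤ 1 - θ := by linarith
      positivity

lemma truncBinomMean_succ_right_le {θ : ℝ} (h0 : 0 ≤ θ) (h1 : θ ≤ 1) (t c : ℕ) :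
    truncBinomMean θ t (c + 1) ≤ 1 + truncBinomMean θ t c := by
  induction t generalizing c with
  | zero => simp [truncBinomMean_zero_left]
  | succ t ih =>
    have h2 : 0 ≤ 1 - θ := by linarith
    cases c with
    | zero =>
      rw [truncBinomMean_succ_succ]
      have := ih 0
      simp only [truncBinomMean_zero_right] at this ⊢
      nlinarith
    | succ c =>
      rw [truncBinomMean_succ_succ, truncBinomMean_succ_succ]
      nlinarith [mul_le_mul_of_nonneg_left (ih c) h0, mul_le_mul_of_nonneg_left (ih (c + 1)) h2]

lemma truncBinomMean_le_right {θ : ℝ} (h0 : 0 ≤ θ) (h1 : θ ≤ 1) (t c : ℕ) :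
    truncBinomMean θ t c ≤ c := by
  induction c with
  | zero => simp [truncBinomMean_zero_right]
  | succ c ih =>
    have := truncBinomMean_succ_right_le h0 h1 t c
    push_cast
    linarith

lemma truncBinomMean_le_succ_left {θ : ℝ} (h0 : 0 ≤ θ) (h1 : θ ≤ 1) (t c : ℕ) :
    truncBinomMean θ t c ≤ truncBinomMean θ (t + 1) c := by
  cases c with
  | zero => simp [truncBinomMean_zero_right]
  | succ c =>
    rw [truncBinomMean_succ_succ]
    nlinarith [mul_le_mul_of_nonneg_left (truncBinomMean_succ_right_le h0 h1 t c) h0]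

lemma truncBinomMean_increment_mono {θ : ℝ} (h0 : 0 ≤ θ) (h1 : θ ≤ 1) (t c : ℕ) :
    truncBinomMean θ (t + 1) c - truncBinomMean θ t c ≤
      truncBinomMean θ (t + 1) (c + 1) - truncBinomMean θ t (c + 1) := by
  induction t generalizing c with
  | zero =>
    cases c with
    | zero => simp [truncBinomMean_zero_left, truncBinomMean_zero_right,
        truncBinomMean_succ_succ, h0]
    | succ c => simp [truncBinomMean_zero_left, truncBinomMean_succ_succ]
  | succ t ih =>
    have h2 : 0 ≤ 1 - θ := by linarith
    cases c with
    | zero =>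
      have := truncBinomMean_le_succ_left h0 h1 (t + 1) 1
      simp only [truncBinomMean_zero_right]
      simpa using this
    | succ c =>
      have e1 := truncBinomMean_succ_succ θ (t + 1) c
      have e2 := truncBinomMean_succ_succ θ (t + 1) (c + 1)
      have e3 := truncBinomMean_succ_succ θ t c
      have e4 := truncBinomMean_succ_succ θ t (c + 1)
      nlinarith [mul_le_mul_of_nonneg_left (ih c) h0, mul_le_mul_of_nonneg_left (ih (c + 1)) h2]

lemma truncBinomMean_concave {θ : ℝ} (h0 : 0 ≤ θ) (h1 : θ ≤ 1) (t c : ℕ) :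
    truncBinomMean θ (t + 2) c - 2 * truncBinomMean θ (t + 1) c + truncBinomMean θ t c ≤ 0 := by
  cases c with
  | zero => simp [truncBinomMean_zero_right]
  | succ c =>
    have e1 := truncBinomMean_succ_succ θ (t + 1) c
    have e2 := truncBinomMean_succ_succ θ t c
    have := mul_le_mul_of_nonneg_left (truncBinomMean_increment_mono h0 h1 t c) h0
    rw [show t + 2 = t + 1 + 1 from rfl]
    nlinarith

lemma summable_geometric_mul_truncBinomMean {θ r : ℝ} (h0 : 0 ≤ θ) (h1 : θ ≤ 1) (hr0 : 0 ≤ r)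
    (hr1 : r < 1) (c : ℕ) : Summable fun t : ℕ => r ^ t * truncBinomMean θ t c := by
  refine Summable.of_nonneg_of_le
    (fun t => mul_nonneg (pow_nonneg hr0 t) (truncBinomMean_nonneg h0 h1 t c))
    (fun t => mul_le_mul_of_nonneg_left (truncBinomMean_le_right h0 h1 t c) (pow_nonneg hr0 t))
    ((summable_geometric_of_lt_one hr0 hr1).mul_right _)

/-- The mean of the binomial truncated at `c` with a geometric number of trials of mean
`r / (1 - r)`, bounded below by half the harmonic mean of `c` and the untruncated mean. -/
lemma geometric_truncBinomMean_lower {θ r : ℝ} (h0 : 0 ≤ θ) (h1 : θ ≤ 1) (hr0 : 0 ≤ r)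
    (hr1 : r < 1) (c : ℕ) {A : ℝ} (hA : 0 < A) (hAr : A * (1 - r) = θ * r) :
    A * c / (A + c) ≤ (1 - r) * ∑' t : ℕ, r ^ t * truncBinomMean θ t c := by
  induction c with
  | zero => simp [truncBinomMean_zero_right]
  | succ c ih =>
    have hs := summable_geometric_mul_truncBinomMean h0 h1 hr0 hr1 c
    have hs' := summable_geometric_mul_truncBinomMean h0 h1 hr0 hr1 (c + 1)
    have hg := summable_geometric_of_lt_one hr0 hr1
    have hrec : ∑' t : ℕ, r ^ t * truncBinomMean θ t (c + 1) =
        r * θ * (∑' t : ℕ, r ^ t) + r * θ * (∑' t : ℕ, r ^ t * truncBinomMean θ t c)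
          + r * (1 - θ) * ∑' t : ℕ, r ^ t * truncBinomMean θ t (c + 1) := by
      conv_lhs => rw [hs'.tsum_eq_zero_add]
      rw [← tsum_mul_left, ← tsum_mul_left, ← tsum_mul_left,
        ← (hg.mul_left _).tsum_add (hs.mul_left _),
        ← ((hg.mul_left _).add (hs.mul_left _)).tsum_add (hs'.mul_left _)]
      simp only [truncBinomMean_zero_left, mul_zero, zero_add]
      refine tsum_congr fun t => ?_
      rw [truncBinomMean_succ_succ]
      ring
    rw [tsum_geometric_of_lt_one hr0 hr1] at hrec
    set G := ∑' t : ℕ, r ^ t * truncBinomMean θ t c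
    set G' := ∑' t : ℕ, r ^ t * truncBinomMean θ t (c + 1)
    have h1r : 0 < 1 - r := by linarith
    have hrec' : (1 - r) * G' * (1 + A) = A * (1 + (1 - r) * G) := by
      have h3 : (1 - r) * (1 - r)⁻¹ = 1 := mul_inv_cancel₀ h1r.ne'
      have h4 : G' * (1 - r + r * θ) = r * θ * ((1 - r)⁻¹ + G) := by linarith
      have h5 : 1 - r + r * θ = (1 - r) * (1 + A) := by linarith
      have h6 : r * θ = A * (1 - r) := by linarith
      rw [h5, h6] at h4
      linear_combination h4 + A * h3
    have hc : (0 : ℝ) ≤ c := Nat.cast_nonneg c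
    have h7 : A * (1 + A * c / (A + c)) ≤ (1 - r) * G' * (1 + A) := by
      rw [hrec']; gcongr
    push_cast
    have h8 : A * (c + 1) / (A + (c + 1)) * (1 + A) ≤ A * (1 + A * c / (A + c)) := by
      have h9 : 0 < A + c := by positivity
      rw [div_mul_eq_mul_div, div_le_iff₀ (by positivity)]
      have : A * (1 + A * c / (A + c)) * (A + (c + 1)) =
          A * (c + 1) * (1 + A) + A * (A * c) / (A + c) := by
        field_simp; ring
      rw [this]
      have : 0 ≤ A * (A * c) / (A + c) := by positivity
      linarith
    exact le_of_mul_le_mul_right (h8.trans h7) (by positivity)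

/-! ### The consumption process -/

lemma Zstoch_bounds {n : ℕ} {v : Fin n → ℝ} (hv : ∀ i, 0 < v i) (i : Fin n) (T : ℕ)
    (x : Fin n → ℕ) : 0 ≤ Zstoch v i T x ∧ Zstoch v i T x ≤ T := by
  induction T generalizing x with
  | zero => simp [Zstoch]
  | succ T ih =>
    rw [Zstoch]
    set N := Finset.univ.filter (fun k => 1 ≤ x k)
    have hV : 0 < 1 + ∑ k ∈ N, v k := by
      have : 0 ≤ ∑ k ∈ N, v k := Finset.sum_nonneg fun k _ => (hv k).le
      linarith
    constructor
    · refine add_nonneg (Finset.sum_nonneg fun j _ => mul_nonneg (div_nonneg (hv j).le hV.le) ?_)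
        (mul_nonneg (by positivity) (ih _).1)
      exact add_nonneg (by split_ifs <;> simp) (ih _).1
    · have hsum : ∑ j ∈ N, v j / (1 + ∑ k ∈ N, v k) * (1 + (T : ℝ)) +
          1 / (1 + ∑ k ∈ N, v k) * (1 + (T : ℝ)) = 1 + T := by
        rw [← Finset.sum_mul, ← Finset.sum_div]
        field_simp
        ring
      push_cast
      rw [add_comm (T : ℝ) 1]
      refine le_trans (add_le_add (Finset.sum_le_sum fun j _ => ?_) ?_) hsum.le
      · refine mul_le_mul_of_nonneg_left (add_le_add ?_ (ih _).2) (div_nonneg (hv j).le hV.le)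
        split_ifs <;> simp
      · exact mul_le_mul_of_nonneg_left (by linarith [(ih x).2]) (by positivity)

/-- Serving every unit of the products in `U` first, and keeping the products outside `U` always
available, can only decrease the consumption of product `i`. -/
lemma truncBinomMean_le_Zstoch {n : ℕ} {v : Fin n → ℝ} (hv : ∀ i, 0 < v i) (i : Fin n)
    (U : Finset (Fin n)) (hi : i ∉ U) {θ : ℝ} (h0 : 0 ≤ θ) (h1 : θ ≤ 1)
    (hθ : θ * (1 + ∑ k ∈ Uᶜ, v k) ≤ v i) (T : ℕ) (x : Fin n → ℕ) :
    truncBinomMean θ (T - ∑ k ∈ U, x k) (x i) ≤ Zstoch v i T x := by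
  induction T generalizing x with
  | zero => simp [Zstoch, truncBinomMean_zero_left]
  | succ T ih =>
    rcases Nat.lt_or_ge T (∑ k ∈ U, x k) with hD | hD
    · rw [Nat.sub_eq_zero_of_le hD, truncBinomMean_zero_left]
      exact (Zstoch_bounds hv i _ x).1
    obtain hxi | ⟨c, hc⟩ : x i = 0 ∨ ∃ c, x i = c + 1 := by
      cases x i <;> simp
    · rw [hxi, truncBinomMean_zero_right]
      exact (Zstoch_bounds hv i _ x).1
    obtain ⟨t, ht⟩ := Nat.exists_eq_add_of_le hD
    have ht1 : T + 1 - ∑ k ∈ U, x k = t + 1 := by omega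
    have ht0 : T - ∑ k ∈ U, x k = t := by omega
    rw [Zstoch, ht1, hc]
    set N := Finset.univ.filter (fun k => 1 ≤ x k) with hN
    have hV : 0 < 1 + ∑ k ∈ N, v k := by
      have : 0 ≤ ∑ k ∈ N, v k := Finset.sum_nonneg fun k _ => (hv k).le
      linarith
    have hiN : i ∈ N := by simp [hN, hc]
    set h := 1 + truncBinomMean θ t c - truncBinomMean θ t (c + 1) with hh
    have hh0 : 0 ≤ h := by
      have := truncBinomMean_succ_right_le h0 h1 t c
      linarith
    have hW : truncBinomMean θ (t + 1) (c + 1) = truncBinomMean θ t (c + 1) + θ * h := by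
      rw [truncBinomMean_succ_succ, hh]; ring
    have hterm : ∀ j ∈ N, truncBinomMean θ (t + 1) (c + 1) + (if j = i then h else 0)
        - (if j ∈ U then 0 else θ * h) ≤
        (if j = i then 1 else 0) + Zstoch v i T (fun k => if k = j then x k - 1 else x k) := by
      intro j hj
      have hxj : 1 ≤ x j := by simpa [hN] using hj
      have hZ := ih (fun k => if k = j then x k - 1 else x k)
      by_cases hjU : j ∈ U
      · have hji : j ≠ i := fun e => hi (e ▸ hjU)
        have hsum : ∑ k ∈ U, (if k = j then x k - 1 else x k) + 1 = ∑ k ∈ U, x k := by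
          rw [← Finset.add_sum_erase _ _ hjU, ← Finset.add_sum_erase _ x hjU]
          have : ∑ k ∈ U.erase j, (if k = j then x k - 1 else x k) = ∑ k ∈ U.erase j, x k :=
            Finset.sum_congr rfl fun k hk => by simp [Finset.ne_of_mem_erase hk]
          rw [this]
          simp only [if_true]
          omega
        have hT : T - ∑ k ∈ U, (if k = j then x k - 1 else x k) = t + 1 := by omega
        simp only [hT, if_neg hji.symm, hc] at hZ
        simp only [hji, hjU, if_true, if_false]
        linarith
      · have hsum : ∑ k ∈ U, (if k = j then x k - 1 else x k) = ∑ k ∈ U, x k :=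
          Finset.sum_congr rfl fun k hk => by
            have : k ≠ j := fun e => hjU (e ▸ hk)
            simp [this]
        by_cases hji : j = i
        · subst hji
          simp only [hsum, ht0, if_true, hc, Nat.add_sub_cancel] at hZ
          simp only [hjU, if_true, if_false]
          linarith
        · simp only [hsum, ht0, if_neg (Ne.symm hji), hc] at hZ
          simp only [hji, hjU, if_false]
          linarith
    have hzero : truncBinomMean θ (t + 1) (c + 1) - θ * h ≤ Zstoch v i T x := by
      have := ih x
      rw [ht0, hc] at this
      linarith
    have key : truncBinomMean θ (t + 1) (c + 1) * (1 + ∑ k ∈ N, v k) ≤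
        ∑ j ∈ N, v j * ((if j = i then 1 else 0) +
          Zstoch v i T (fun k => if k = j then x k - 1 else x k)) + Zstoch v i T x := by
      refine le_trans ?_ (add_le_add
        (Finset.sum_le_sum fun j hj => mul_le_mul_of_nonneg_left (hterm j hj) (hv j).le) hzero)
      have e1 : ∑ j ∈ N, v j * (truncBinomMean θ (t + 1) (c + 1) + (if j = i then h else 0)
          - (if j ∈ U then 0 else θ * h)) =
          (∑ j ∈ N, v j) * truncBinomMean θ (t + 1) (c + 1) + v i * h
            - (∑ j ∈ N, if j ∈ U then 0 else v j) * (θ * h) := by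
        rw [Finset.sum_mul, Finset.sum_mul]
        have : v i * h = ∑ j ∈ N, v j * (if j = i then h else 0) := by
          simp [hiN]
        rw [this, ← Finset.sum_add_distrib, ← Finset.sum_sub_distrib]
        refine Finset.sum_congr rfl fun j _ => ?_
        split_ifs <;> ring
      have e2 : (∑ j ∈ N, if j ∈ U then 0 else v j) ≤ ∑ k ∈ Uᶜ, v k := by
        rw [show (∑ j ∈ N, if j ∈ U then 0 else v j) = ∑ j ∈ N with j ∉ U, v j by
          simp [Finset.sum_filter]]
        refine Finset.sum_le_sum_of_subset_of_nonneg (fun k hk => ?_) fun k _ _ => (hv k).le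
        simp only [Finset.mem_filter] at hk
        simpa using hk.2
      rw [e1]
      nlinarith [mul_le_mul_of_nonneg_right e2 (mul_nonneg h0 hh0),
        mul_le_mul_of_nonneg_right hθ hh0]
    have e3 : (∑ j ∈ N, v j / (1 + ∑ k ∈ N, v k) * ((if j = i then 1 else 0) +
          Zstoch v i T (fun k => if k = j then x k - 1 else x k))) +
        (1 / (1 + ∑ k ∈ N, v k)) * Zstoch v i T x =
        (∑ j ∈ N, v j * ((if j = i then 1 else 0) +
          Zstoch v i T (fun k => if k = j then x k - 1 else x k)) + Zstoch v i T x) /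
          (1 + ∑ k ∈ N, v k) := by
      rw [add_div, Finset.sum_div, one_div_mul_eq_div]
      congr 1
      exact Finset.sum_congr rfl fun j _ => by ring
    rw [e3, le_div_iff₀ hV]
    exact key

/-! ### Comparison of second differences -/

lemma sum_second_difference_mul (U f : ℕ → ℝ) (hU0 : U 0 = 0) (hU1 : U 1 = 0) (N : ℕ) :
    ∑ t ∈ range N, (U t - 2 * U (t + 1) + U (t + 2)) * f t =
      ∑ t ∈ range N, U (t + 2) * (f (t + 2) - 2 * f (t + 1) + f t)
        + (2 * U (N + 1) * f N - U N * f N - U (N + 1) * f (N + 1)) := by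
  induction N with
  | zero => simp [hU0, hU1]
  | succ N ih =>
    rw [sum_range_succ, sum_range_succ, ih]
    ring

lemma tsum_second_difference_mul_nonneg {U f : ℕ → ℝ} (hU0 : U 0 = 0) (hU1 : U 1 = 0)
    (hU : ∀ t, U t ≤ 0) (hlim : Tendsto U atTop (𝓝 0)) {C : ℝ} (hf : ∀ t, |f t| ≤ C)
    (hconc : ∀ t, f (t + 2) - 2 * f (t + 1) + f t ≤ 0)
    (hs : Summable fun t => (U t - 2 * U (t + 1) + U (t + 2)) * f t) :
    0 ≤ ∑' t, (U t - 2 * U (t + 1) + U (t + 2)) * f t := by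
  have hmul : ∀ {a b : ℕ → ℝ}, Tendsto a atTop (𝓝 0) → (∀ t, |b t| ≤ C) →
      Tendsto (fun t => a t * b t) atTop (𝓝 0) := by
    intro a b ha hb
    refine squeeze_zero_norm (a := fun t => |a t| * C) (fun t => ?_) ?_
    · rw [Real.norm_eq_abs, abs_mul]
      exact mul_le_mul_of_nonneg_left (hb t) (abs_nonneg _)
    · simpa using ha.abs.mul_const C
  have hlim1 : Tendsto (fun t => U (t + 1)) atTop (𝓝 0) := (tendsto_add_atTop_iff_nat 1).2 hlim
  have hB : Tendsto (fun N => 2 * U (N + 1) * f N - U N * f N - U (N + 1) * f (N + 1))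
      atTop (𝓝 0) := by
    have h1 : Tendsto (fun N => 2 * U (N + 1) * f N) atTop (𝓝 0) :=
      hmul (by simpa using hlim1.const_mul 2) hf
    have h2 := hmul hlim hf
    have h3 := hmul hlim1 (fun t => hf (t + 1))
    simpa using (h1.sub h2).sub h3
  refine le_of_tendsto_of_tendsto hB hs.hasSum.tendsto_sum_nat (Eventually.of_forall fun N => ?_)
  show _ ≤ ∑ t ∈ range N, (U t - 2 * U (t + 1) + U (t + 2)) * f t
  rw [sum_second_difference_mul U f hU0 hU1]
  have : 0 ≤ ∑ t ∈ range N, U (t + 2) * (f (t + 2) - 2 * f (t + 1) + f t) :=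
    Finset.sum_nonneg fun t _ => mul_nonneg_of_nonpos_of_nonpos (hU _) (hconc t)
  linarith

/-! ### Survival functions with bounded hazard rate -/

lemma sum_shift_le_of_ratio {S : ℕ → ℝ} {m : ℝ} (hm : 0 < m) (a N : ℕ)
    (hS : ∀ j < a + N, S j ≤ (1 + 1 / m) * S (j + 1)) :
    ∑ k ∈ range N, S (a + k + 1) ≤ S (a + N) * m * ((1 + 1 / m) ^ N - 1) := by
  induction N with
  | zero => simp
  | succ N ih =>
    rw [sum_range_succ]
    have h1 := ih fun j hj => hS j (by omega)
    have h2 := hS (a + N) (by omega)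
    have h3 : 0 ≤ m * ((1 + 1 / m) ^ N - 1) := by
      have : (1 : ℝ) ≤ (1 + 1 / m) ^ N := one_le_pow₀ (by
        have : 0 < 1 / m := by positivity
        linarith)
      exact mul_nonneg hm.le (by linarith)
    have h4 : m * (1 / m) = 1 := by field_simp
    have h5 := mul_le_mul_of_nonneg_right h2 h3
    rw [pow_succ, show a + (N + 1) = a + N + 1 from rfl]
    linear_combination h1 + h5 - S (a + N + 1) * h4

lemma one_add_mul_pow_le {s t : ℝ} (ht : 0 < t) (K : ℕ)
    (h1 : s * (1 + t) ^ K ≤ 1) (h2 : 1 ≤ s * (1 + t) ^ (K + 1)) :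
    1 + s * (1 + t) ^ (K + 1) ≤ Real.exp 1 * s + (K + 1) * t := by
  have hexp : ∀ k : ℕ, (1 + t) ^ k * (2 - k * t) ≤ Real.exp 1 := by
    intro k
    have e1 : (1 + t) ^ k ≤ Real.exp (k * t) := by
      rw [Real.exp_nat_mul]
      exact pow_le_pow_left₀ (by positivity) (by linarith [Real.add_one_le_exp t]) k
    have e2 : 2 - k * t ≤ Real.exp (1 - k * t) := by
      linarith [Real.add_one_le_exp (1 - k * t)]
    calc (1 + t) ^ k * (2 - k * t) ≤ (1 + t) ^ k * Real.exp (1 - k * t) := by gcongr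
      _ ≤ Real.exp (k * t) * Real.exp (1 - k * t) := by gcongr
      _ = Real.exp 1 := by rw [← Real.exp_add]; ring_nf
  have a1 := hexp K
  have a2 := hexp (K + 1)
  have hp : 0 < (1 + t) ^ K := by positivity
  rw [pow_succ] at h2 a2 ⊢
  push_cast at a2
  set p := (1 + t) ^ K
  set E := Real.exp 1
  have hs : 0 < s := by
    by_contra hs
    have : s * (p * (1 + t)) ≤ 0 := mul_nonpos_of_nonpos_of_nonneg (by linarith) (by positivity)
    linarith
  have b1 := mul_nonneg (sub_nonneg.2 a1) (sub_nonneg.2 h2)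
  have b2 := mul_nonneg (sub_nonneg.2 a2) (sub_nonneg.2 h1)
  have hfin : 0 ≤ (E * s + (K + 1) * t - (1 + s * (p * (1 + t)))) * (t * p) := by
    linear_combination b1 + b2
  have := nonneg_of_mul_nonneg_left hfin (by positivity)
  linarith

lemma mean_bound_of_ratio {S : ℕ → ℝ} (hS0 : S 0 = 1) (hS1 : ∀ k, S k ≤ 1) {m : ℝ} (hm : 0 < m)
    (D : ℕ) (hS : ∀ j < D, S j ≤ (1 + 1 / m) * S (j + 1)) :
    m + (∑ k ∈ range D, S (k + 1) + S D * m) - D ≤ Real.exp 1 * (S D * m) := by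
  have hu : 0 < 1 / m := by positivity
  have hpow : ∀ N ≤ D, 1 ≤ S N * (1 + 1 / m) ^ N := by
    intro N hN
    induction N with
    | zero => simp [hS0]
    | succ N ih =>
      have h1 := ih (by omega)
      have h2 := mul_le_mul_of_nonneg_right (hS N (by omega))
        (by positivity : 0 ≤ (1 + 1 / m) ^ N)
      rw [pow_succ]
      linarith
  have hex : ∃ N, 1 ≤ S D * (1 + 1 / m) ^ N := ⟨D, hpow D le_rfl⟩
  classical
  have hND : Nat.find hex ≤ D := Nat.find_min' hex (hpow D le_rfl)
  have hspec := Nat.find_spec hex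
  rcases hN : Nat.find hex with _ | K
  · rw [hN] at hspec
    have hsum : ∑ k ∈ range D, S (k + 1) ≤ D := by
      calc ∑ k ∈ range D, S (k + 1) ≤ ∑ _k ∈ range D, (1 : ℝ) := sum_le_sum fun k _ => hS1 _
        _ = D := by simp
    have hSD : S D = 1 := le_antisymm (hS1 D) (by simpa using hspec)
    rw [hSD]
    nlinarith [Real.add_one_le_exp 1]
  · have hlt : S D * (1 + 1 / m) ^ K ≤ 1 := by
      have := Nat.find_min hex (m := K) (by omega)
      linarith
    rw [hN] at hspec hND
    have hmain := one_add_mul_pow_le hu K hlt hspec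
    obtain ⟨a, rfl⟩ : ∃ a, D = a + (K + 1) := ⟨D - (K + 1), by omega⟩
    have h1 := sum_shift_le_of_ratio hm a (K + 1) hS
    have h2 : ∑ k ∈ range a, S (k + 1) ≤ a := by
      calc ∑ k ∈ range a, S (k + 1) ≤ ∑ _k ∈ range a, (1 : ℝ) := sum_le_sum fun k _ => hS1 _
        _ = a := by simp
    rw [sum_range_add]
    have h3 := mul_le_mul_of_nonneg_left hmain hm.le
    have h4 : m * (1 / m) = 1 := by field_simp
    push_cast
    linear_combination h1 + h2 + h3 + (K + 1) * h4

/-! ### Tail sums -/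

section Tail

variable {q : ℕ → ℝ}

lemma tailP_eq_add (hqs : Summable q) (k : ℕ) : tailP q k = q k + tailP q (k + 1) := by
  unfold tailP
  rw [((summable_nat_add_iff k).2 hqs |>.congr fun j => by rw [add_comm]).tsum_eq_zero_add]
  simp only [add_zero]
  congr 1
  exact tsum_congr fun j => by congr 1; omega

lemma tailP_nonneg (hq0 : ∀ k, 0 ≤ q k) (k : ℕ) : 0 ≤ tailP q k :=
  tsum_nonneg fun _ => hq0 _

lemma tailP_antitone (hq0 : ∀ k, 0 ≤ q k) (hqs : Summable q) : Antitone (tailP q) :=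
  antitone_nat_of_succ_le fun k => by rw [tailP_eq_add hqs k]; linarith [hq0 k]

lemma tailP_mul_le (hq0 : ∀ k, 0 ≤ q k) (hqs : Summable q) (hIFR : IFR q) (j i : ℕ) :
    tailP q j * tailP q (j + i + 1) ≤ tailP q (j + 1) * tailP q (j + i) := by
  induction i with
  | zero => simp [mul_comm]
  | succ i ih =>
    have hI := hIFR (j + i)
    have e1 := tailP_eq_add hqs (j + i)
    have e2 := tailP_eq_add hqs (j + i + 1)
    have hlc : tailP q (j + i) * tailP q (j + i + 1 + 1) ≤
        tailP q (j + i + 1) * tailP q (j + i + 1) := by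
      rw [show q (j + i) = tailP q (j + i) - tailP q (j + i + 1) by linarith,
        show q (j + i + 1) = tailP q (j + i + 1) - tailP q (j + i + 1 + 1) by linarith] at hI
      linarith
    have n1 := tailP_nonneg hq0 j
    have n2 := tailP_nonneg hq0 (j + i + 1)
    have n3 := tailP_antitone hq0 hqs (Nat.le_succ (j + i))
    have n4 := tailP_antitone hq0 hqs (Nat.le_succ (j + i + 1))
    have n5 := tailP_nonneg hq0 (j + i + 1 + 1)
    simp only [Nat.succ_eq_add_one] at n3 n4
    rw [← add_assoc]
    rcases n2.eq_or_lt with h | h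
    · have : tailP q (j + i + 1 + 1) = 0 := by linarith
      rw [this, ← h]
      simp
    · have hp : 0 < tailP q (j + i) := by linarith
      refine le_of_mul_le_mul_right ?_ hp
      nlinarith [mul_le_mul_of_nonneg_left hlc n1, mul_le_mul_of_nonneg_right ih n2]

lemma hasSum_tailP_succ (hq0 : ∀ k, 0 ≤ q k) (hqs : Summable q)
    (hms : Summable fun k : ℕ => (k : ℝ) * q k) :
    HasSum (fun k => tailP q (k + 1)) (∑' k : ℕ, (k : ℝ) * q k) := by
  rw [hasSum_iff_tendsto_nat_of_nonneg fun k => tailP_nonneg hq0 _]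
  have hid : ∀ N : ℕ, ∑ k ∈ range N, tailP q (k + 1) =
      ∑ k ∈ range N, (k : ℝ) * q k + N * tailP q N := by
    intro N
    induction N with
    | zero => simp
    | succ N ih =>
      rw [sum_range_succ, sum_range_succ, ih]
      have := tailP_eq_add hqs N
      push_cast
      rw [this]
      ring
  have hN : Tendsto (fun N : ℕ => N * tailP q N) atTop (𝓝 0) := by
    have hlim := tendsto_sum_nat_add fun k : ℕ => (k : ℝ) * q k
    refine squeeze_zero (fun N => mul_nonneg (Nat.cast_nonneg _) (tailP_nonneg hq0 _))
      (fun N => ?_) hlim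
    unfold tailP
    rw [← tsum_mul_left]
    have s1 : Summable fun j => q (N + j) :=
      ((summable_nat_add_iff N).2 hqs).congr fun j => by rw [add_comm]
    refine Summable.tsum_le_tsum (fun j => ?_) (s1.mul_left _) ((summable_nat_add_iff N).2 hms)
    rw [add_comm j N]
    push_cast
    exact mul_le_mul_of_nonneg_right (by linarith [Nat.cast_nonneg (α := ℝ) j]) (hq0 _)
  simp_rw [hid]
  simpa using hms.hasSum.tendsto_sum_nat.add hN

/-- The integrated tail `∑_{j ≥ k} P(T ≥ j)`. -/
noncomputable def integratedTail (q : ℕ → ℝ) (k : ℕ) : ℝ := tailP (tailP q) k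

lemma integratedTail_mul_le (hq0 : ∀ k, 0 ≤ q k) (hqs : Summable q) (hIFR : IFR q)
    (hS : Summable (tailP q)) {j k : ℕ} (hjk : j ≤ k) :
    tailP q j * integratedTail q (k + 1) ≤ tailP q (j + 1) * integratedTail q k := by
  unfold integratedTail
  conv_lhs => unfold tailP
  conv_rhs => unfold tailP
  change tailP q j * ∑' i, tailP q (k + 1 + i) ≤ tailP q (j + 1) * ∑' i, tailP q (k + i)
  have s : ∀ k, Summable fun i => tailP q (k + i) := fun k =>
    ((summable_nat_add_iff k).2 hS).congr fun i => by rw [add_comm]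
  rw [← tsum_mul_left, ← tsum_mul_left]
  refine Summable.tsum_le_tsum (fun i => ?_) ((s _).mul_left _) ((s _).mul_left _)
  have := tailP_mul_le hq0 hqs hIFR j (k - j + i)
  rw [show j + (k - j + i) + 1 = k + 1 + i by omega, show j + (k - j + i) = k + i by omega] at this
  exact this

lemma integratedTail_add_le (hq0 : ∀ k, 0 ≤ q k) (hqs : Summable q) (hIFR : IFR q)
    (hS : Summable (tailP q)) (D t : ℕ) (hR : 0 < integratedTail q D) :
    integratedTail q (D + t) ≤
      integratedTail q D * (integratedTail q (D + 1) / integratedTail q D) ^ t := by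
  have hR0 : ∀ k, 0 ≤ integratedTail q k := fun k => tailP_nonneg (tailP_nonneg hq0) k
  have hstep : ∀ t, integratedTail q (D + t + 1) * integratedTail q D ≤
      integratedTail q (D + 1) * integratedTail q (D + t) := by
    intro t
    induction t with
    | zero => simp
    | succ t ih =>
      have e1 : integratedTail q (D + t) = tailP q (D + t) + integratedTail q (D + t + 1) :=
        tailP_eq_add hS _
      have e2 : integratedTail q (D + t + 1) =
          tailP q (D + t + 1) + integratedTail q (D + t + 1 + 1) := tailP_eq_add hS _
      have h := integratedTail_mul_le hq0 hqs hIFR hS (le_refl (D + t))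
      rw [← add_assoc]
      have hlc : integratedTail q (D + t + 1 + 1) * integratedTail q (D + t) ≤
          integratedTail q (D + t + 1) * integratedTail q (D + t + 1) := by
        rw [show tailP q (D + t) = integratedTail q (D + t) - integratedTail q (D + t + 1) by
          linarith, show tailP q (D + t + 1) = integratedTail q (D + t + 1) -
          integratedTail q (D + t + 1 + 1) by linarith] at h
        linarith
      have n0 := hR0 (D + t)
      have n1 := hR0 (D + t + 1)
      have n2 := hR0 (D + t + 1 + 1)
      have t0 := tailP_nonneg hq0 (D + t + 1)
      have t1 := tailP_nonneg hq0 (D + t)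
      rcases n0.eq_or_lt with h0 | h0
      · have a1 : integratedTail q (D + t + 1) = 0 := by linarith
        have a2 : integratedTail q (D + t + 1 + 1) = 0 := by linarith
        rw [a1, a2]
        simp
      · refine le_of_mul_le_mul_right ?_ h0
        nlinarith [mul_le_mul_of_nonneg_right hlc hR.le, mul_le_mul_of_nonneg_right ih n1]
  induction t with
  | zero => simp
  | succ t ih =>
    rw [pow_succ, ← mul_assoc, ← add_assoc]
    refine le_trans ?_ (mul_le_mul_of_nonneg_right ih (div_nonneg (hR0 _) hR.le))
    rw [mul_div_assoc', le_div_iff₀ hR]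
    linarith [hstep t]

/-- For an IFR number of trials conditioned to be at least `D`, the mean of a truncated binomial
is at least half the harmonic mean of the truncation level and the untruncated mean. -/
lemma IFR_truncBinomMean_lower (hq0 : ∀ k, 0 ≤ q k) (hqs : Summable q) (hIFR : IFR q)
    (hS : Summable (tailP q)) {θ : ℝ} (h0 : 0 < θ) (h1 : θ ≤ 1) (c D : ℕ)
    (hSD : 0 < tailP q D) {m : ℝ} (hm : 0 < m) (hmR : tailP q D * m = integratedTail q (D + 1)) :
    tailP q D * (θ * m * c / (θ * m + c)) ≤ ∑' t, q (D + t) * truncBinomMean θ t c := by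
  have hRD : integratedTail q D = tailP q D + integratedTail q (D + 1) := tailP_eq_add hS D
  have hR : 0 < integratedTail q D := by rw [hRD, ← hmR]; positivity
  set r := integratedTail q (D + 1) / integratedTail q D with hr
  have hrm : r * integratedTail q D = integratedTail q (D + 1) := div_mul_cancel₀ _ hR.ne'
  have hr0 : 0 ≤ r := by
    rw [hr, ← hmR]; positivity
  have h1r : (1 - r) * integratedTail q D = tailP q D := by linarith
  have hr1 : r < 1 := by
    have : 0 < 1 - r := pos_of_mul_pos_left (by rw [h1r]; exact hSD) hR.le
    linarith
  have hmr : m * (1 - r) = r := by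
    have : m * (1 - r) * integratedTail q D = r * integratedTail q D := by
      linear_combination m * h1r + hmR - hrm
    exact mul_right_cancel₀ hR.ne' this
  set f := fun t => truncBinomMean θ t c with hf
  set U := fun t => integratedTail q (D + t) - integratedTail q D * r ^ t with hU
  have hdiff : ∀ t, U t - 2 * U (t + 1) + U (t + 2) =
      q (D + t) - tailP q D * (1 - r) * r ^ t := by
    intro t
    have e1 : integratedTail q (D + t) = tailP q (D + t) + integratedTail q (D + (t + 1)) :=
      tailP_eq_add hS _
    have e2 : integratedTail q (D + (t + 1)) =
        tailP q (D + t + 1) + integratedTail q (D + (t + 2)) := tailP_eq_add hS _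
    have e3 := tailP_eq_add hqs (D + t)
    simp only [hU]
    rw [← h1r]
    linear_combination e1 - e2 + e3
  have hfC : ∀ t, |f t| ≤ c := fun t => by
    rw [abs_of_nonneg (truncBinomMean_nonneg h0.le h1 t c)]
    exact truncBinomMean_le_right h0.le h1 t c
  have s1 : Summable fun t => q (D + t) * f t := by
    have hq' : Summable fun t => q (D + t) :=
      ((summable_nat_add_iff D).2 hqs).congr fun j => by rw [add_comm]
    exact Summable.of_nonneg_of_le
      (fun t => mul_nonneg (hq0 _) (truncBinomMean_nonneg h0.le h1 t c))
      (fun t => mul_le_mul_of_nonneg_left (truncBinomMean_le_right h0.le h1 t c) (hq0 _))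
      (hq'.mul_right _)
  have s2 : Summable fun t => r ^ t * f t :=
    summable_geometric_mul_truncBinomMean h0.le h1 hr0 hr1 c
  have e : ∀ t, (U t - 2 * U (t + 1) + U (t + 2)) * f t =
      q (D + t) * f t - tailP q D * (1 - r) * (r ^ t * f t) := fun t => by rw [hdiff]; ring
  have hlim : Tendsto U atTop (𝓝 0) := by
    have l1 : Tendsto (fun t => integratedTail q (D + t)) atTop (𝓝 0) := by
      have l := tendsto_sum_nat_add (tailP q)
      have : integratedTail q = fun i => ∑' k, tailP q (k + i) := by
        funext i
        unfold integratedTail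
        conv_lhs => unfold tailP
        exact tsum_congr fun k => by rw [add_comm]; rfl
      rw [← this] at l
      simpa [add_comm] using (tendsto_add_atTop_iff_nat D).2 l
    have l2 := (tendsto_pow_atTop_nhds_zero_of_lt_one hr0 hr1).const_mul (integratedTail q D)
    simpa [hU] using l1.sub l2
  have hnn := tsum_second_difference_mul_nonneg (U := U) (f := f) (C := c) (by simp [hU])
    (by simp only [hU, pow_one]; linarith)
    (fun t => sub_nonpos.2 (integratedTail_add_le hq0 hqs hIFR hS D t hR)) hlim hfC
    (fun t => truncBinomMean_concave h0.le h1 t c)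
    ((s1.sub (s2.mul_left (tailP q D * (1 - r)))).congr fun t => (e t).symm)
  simp_rw [e] at hnn
  rw [s1.tsum_sub (s2.mul_left _), tsum_mul_left] at hnn
  have hgeo := geometric_truncBinomMean_lower h0.le h1 hr0 hr1 c (A := θ * m) (by positivity)
    (by rw [mul_assoc, hmr])
  have := mul_le_mul_of_nonneg_left hgeo hSD.le
  simp only [hf] at hnn ⊢
  linarith

end Tail

/-! ### The fluid process -/

lemma Z0FP_spec {n : ℕ} {v x : Fin n → ℝ} (hv : ∀ i, 0 < v i) (hx : ∀ i, 0 ≤ x i) {T : ℝ}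
    (hT : 0 ≤ T) : 0 ≤ Z0FP v x T ∧ Z0FP v x T + ∑ i, min (v i * Z0FP v x T) (x i) = T := by
  have hcont : Continuous fun z : ℝ => z + ∑ i, min (v i * z) (x i) := by fun_prop
  have hclosed : IsClosed {z : ℝ | 0 ≤ z ∧ z + ∑ i, min (v i * z) (x i) = T} :=
    (isClosed_le continuous_const continuous_id).inter (isClosed_eq hcont continuous_const)
  have hne : {z : ℝ | 0 ≤ z ∧ z + ∑ i, min (v i * z) (x i) = T}.Nonempty := by
    have h0 : (0 : ℝ) + ∑ i, min (v i * 0) (x i) ≤ T := by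
      simpa [min_eq_left (hx _)] using hT
    have h1 : T ≤ T + ∑ i, min (v i * T) (x i) :=
      le_add_of_nonneg_right (Finset.sum_nonneg fun i _ =>
        le_min (mul_nonneg (hv i).le hT) (hx i))
    obtain ⟨z, hz, hzT⟩ := intermediate_value_Icc hT hcont.continuousOn ⟨h0, h1⟩
    exact ⟨z, hz.1, hzT⟩
  exact hclosed.csInf_mem hne ⟨0, fun z hz => hz.1⟩

theorem stmt14 {n : ℕ} (hn : 1 ≤ n) (r v : Fin n → ℝ)
    (hr : ∀ i j : Fin n, i ≤ j → r j ≤ r i) (hr0 : ∀ i, 0 ≤ r i)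
    (hv : ∀ i, 0 < v i)
    (q : ℕ → ℝ) (hq0 : ∀ k, 0 ≤ q k) (hqs : Summable q)
    (hq1 : ∑' k, q k = 1) (hIFR : IFR q)
    (μ : ℝ) (hms : Summable (fun k : ℕ => (k : ℝ) * q k))
    (hμ : μ = ∑' k : ℕ, (k : ℝ) * q k)
    (x : Fin n → ℕ) (i : Fin n) :
    (1 / Real.exp 1) * ZFP v (fun k => (x k : ℝ)) i μ ≤
      ∑' T : ℕ, q T * Zstoch v i T x := by
  have hμ0 : 0 ≤ μ := by
    rw [hμ]; exact tsum_nonneg fun k => mul_nonneg (Nat.cast_nonneg k) (hq0 k)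
  have hZ0 : ∀ T, 0 ≤ q T * Zstoch v i T x := fun T =>
    mul_nonneg (hq0 T) (Zstoch_bounds hv i T x).1
  have hZs : Summable fun T => q T * Zstoch v i T x :=
    Summable.of_nonneg_of_le hZ0 (fun T => by
      rw [mul_comm]
      exact mul_le_mul_of_nonneg_right (Zstoch_bounds hv i T x).2 (hq0 T)) hms
  obtain ⟨hz0, hz⟩ := Z0FP_spec hv (x := fun k => (x k : ℝ)) (fun k => Nat.cast_nonneg _) hμ0
  unfold ZFP
  set z := Z0FP v (fun k => (x k : ℝ)) μ
  set y := min (v i * z) (x i : ℝ) with hy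
  have hy0 : 0 ≤ y := le_min (mul_nonneg (hv i).le hz0) (Nat.cast_nonneg _)
  rcases hy0.eq_or_lt with hy0' | hypos
  · rw [← hy0', mul_zero]
    exact tsum_nonneg hZ0
  have hzpos : 0 < z := by
    have : 0 < v i * z := hypos.trans_le (min_le_left _ _)
    exact pos_of_mul_pos_right this (hv i).le
  set U := (univ.filter fun k => (x k : ℝ) ≤ v k * z).erase i with hU
  have hiU : i ∉ U := by simp [hU]
  set D := ∑ k ∈ U, x k with hD
  set V := ∑ k ∈ Uᶜ.erase i, v k with hV
  have hV0 : 0 ≤ V := Finset.sum_nonneg fun k _ => (hv k).le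
  have hVi : ∑ k ∈ Uᶜ, v k = v i + V := (Finset.add_sum_erase _ v (by simpa using hiU)).symm
  have hsplit : μ = D + (1 + V) * z + y := by
    rw [← hz, ← Finset.sum_add_sum_compl U, ← Finset.add_sum_erase Uᶜ _ (by simpa using hiU)]
    have e1 : ∑ k ∈ U, min (v k * z) (x k : ℝ) = D := by
      rw [hD]
      push_cast
      refine Finset.sum_congr rfl fun k hk => min_eq_right ?_
      simpa [hU] using (Finset.mem_erase.1 hk).2
    have e2 : ∑ k ∈ Uᶜ.erase i, min (v k * z) (x k : ℝ) = V * z := by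
      rw [hV, Finset.sum_mul]
      refine Finset.sum_congr rfl fun k hk => min_eq_left ?_
      have h := Finset.mem_erase.1 hk
      by_contra hlt
      have : k ∈ U := by simp [hU, h.1, (not_le.1 hlt).le]
      exact (Finset.mem_compl.1 h.2) this
    rw [e1, e2]
    ring
  set L := (1 + V) * z with hL
  have hLpos : 0 < L := by positivity
  set θ := y / (y + L) with hθ
  have hθpos : 0 < θ := by positivity
  have hθ1 : θ ≤ 1 := by
    rw [hθ, div_le_one (by positivity)]; linarith
  have hθy : θ * (μ - D) = y := by
    rw [hsplit, hθ]; field_simp; ring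
  have hθv : θ * (1 + ∑ k ∈ Uᶜ, v k) ≤ v i := by
    rw [hVi, hθ, div_mul_eq_mul_div, div_le_iff₀ (by positivity)]
    have : y * (1 + V) ≤ v i * z * (1 + V) :=
      mul_le_mul_of_nonneg_right (min_le_left _ _) (by positivity)
    rw [hL]
    nlinarith
  have hS' := hasSum_tailP_succ hq0 hqs hms
  rw [← hμ] at hS'
  have hS : Summable (tailP q) := (summable_nat_add_iff 1).1 hS'.summable
  have hS0 : tailP q 0 = 1 := by simpa [tailP] using hq1
  have hS1 : ∀ k, tailP q k ≤ 1 := fun k =>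
    hS0 ▸ tailP_antitone hq0 hqs (Nat.zero_le k)
  have hμsplit : ∑ k ∈ range D, tailP q (k + 1) + integratedTail q (D + 1) = μ := by
    rw [← hS'.tsum_eq, ← hS'.summable.sum_add_tsum_nat_add D]
    congr 1
    unfold integratedTail
    conv_lhs => unfold tailP
    exact tsum_congr fun k => by rw [show D + 1 + k = k + D + 1 by omega]; rfl
  have hRpos : 0 < integratedTail q (D + 1) := by
    have : ∑ k ∈ range D, tailP q (k + 1) ≤ D := by
      calc ∑ k ∈ range D, tailP q (k + 1) ≤ ∑ _k ∈ range D, (1 : ℝ) :=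
            sum_le_sum fun k _ => hS1 _
        _ = D := by simp
    linarith
  have hSD : 0 < tailP q D := by
    refine (tailP_nonneg hq0 D).lt_of_ne fun h => hRpos.ne' ?_
    have hz : ∀ k, tailP q (D + 1 + k) = 0 := fun k =>
      le_antisymm (h ▸ tailP_antitone hq0 hqs (by omega)) (tailP_nonneg hq0 _)
    unfold integratedTail
    rw [tailP]
    simp [hz]
  set m := integratedTail q (D + 1) / tailP q D with hm
  have hmpos : 0 < m := by positivity
  have hmR : tailP q D * m = integratedTail q (D + 1) := mul_div_cancel₀ _ hSD.ne'
  have hratio : ∀ j < D, tailP q j ≤ (1 + 1 / m) * tailP q (j + 1) := by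
    intro j hj
    have h := integratedTail_mul_le hq0 hqs hIFR hS hj.le
    have hRD : integratedTail q D = tailP q D + integratedTail q (D + 1) := tailP_eq_add hS D
    rw [hRD, ← hmR] at h
    have h' : tailP q j * m ≤ (1 + m) * tailP q (j + 1) := by
      refine le_of_mul_le_mul_right ?_ hSD
      linarith
    rw [show (1 + 1 / m) * tailP q (j + 1) = (1 + m) * tailP q (j + 1) / m by field_simp; ring,
      le_div_iff₀ hmpos]
    exact h'
  have hmean := mean_bound_of_ratio hS0 hS1 hmpos D hratio
  rw [hmR, hμsplit, ← hmR] at hmean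
  have hlow := IFR_truncBinomMean_lower hq0 hqs hIFR hS hθpos hθ1 (x i) D hSD hmpos hmR
  have hZlow : ∑' t, q (D + t) * truncBinomMean θ t (x i) ≤ ∑' T, q T * Zstoch v i T x := by
    have hZs' : Summable fun t => q (D + t) * Zstoch v i (D + t) x :=
      ((summable_nat_add_iff D).2 hZs).congr fun t => by rw [add_comm]
    have hle : ∀ t, q (D + t) * truncBinomMean θ t (x i) ≤
        q (D + t) * Zstoch v i (D + t) x := fun t => by
      have := truncBinomMean_le_Zstoch hv i U hiU hθpos.le hθ1 hθv (D + t) x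
      rw [← hD, Nat.add_sub_cancel_left] at this
      exact mul_le_mul_of_nonneg_left this (hq0 _)
    calc ∑' t, q (D + t) * truncBinomMean θ t (x i)
        ≤ ∑' t, q (D + t) * Zstoch v i (D + t) x :=
          Summable.tsum_le_tsum hle (Summable.of_nonneg_of_le (fun t => mul_nonneg (hq0 _)
            (truncBinomMean_nonneg hθpos.le hθ1 _ _)) hle hZs') hZs'
      _ ≤ ∑ T ∈ range D, q T * Zstoch v i T x + ∑' t, q (D + t) * Zstoch v i (D + t) x :=
          le_add_of_nonneg_left (Finset.sum_nonneg fun T _ => hZ0 T)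
      _ = ∑' T, q T * Zstoch v i T x := by
          rw [← hZs.sum_add_tsum_nat_add D]
          simp only [add_comm D]
  refine le_trans ?_ (hlow.trans hZlow)
  have hyx : y ≤ x i := min_le_right _ _
  have hA : 0 < θ * m := by positivity
  have hharm : θ * m * y / (θ * m + y) ≤ θ * m * (x i) / (θ * m + x i) := by
    rw [div_le_div_iff₀ (by positivity) (by linarith)]
    nlinarith [mul_le_mul_of_nonneg_left hyx (mul_pos hA hA).le]
  refine le_trans ?_ (mul_le_mul_of_nonneg_left hharm hSD.le)
  have hgap : 0 < m + (μ - D) := by rw [hsplit]; linarith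
  have hval : θ * m * y / (θ * m + y) = y * (m / (m + (μ - D))) := by
    rw [show θ * m + y = θ * (m + (μ - D)) by rw [mul_add, hθy]]
    field_simp
  rw [hval, one_div_mul_eq_div, div_le_iff₀ (Real.exp_pos 1)]
  have hone : 1 ≤ Real.exp 1 * (tailP q D * m) / (m + (μ - D)) := by
    rw [le_div_iff₀ hgap]; linarith
  calc y = y * 1 := (mul_one y).symm
    _ ≤ y * (Real.exp 1 * (tailP q D * m) / (m + (μ - D))) :=
        mul_le_mul_of_nonneg_left hone hy0
    _ = _ := by ring
end
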